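/- Consider the double integrator control system x₁'(t) = x₂(t), x₂'(t) = u(t) with state constraint x₂(t) ≥ -1 and input constraint -1 ≤ u(t) ≤ 1 for all t. Among all measurable controls u : ℝ → ℝ and corresponding differentiable trajectories x = (x₁, x₂) : ℝ → ℝ² satisfying these dynamics and constraints on [0, T], with initial condition x(0) = (1, 1) and terminal condition x(T) = (0, 0), the infimum of the horizon length T (the minimum time to steer the state from (1,1) to the origin) equals 3.5. -/

import Mathlib

/-- The positive part of a real number to a power at least two is differentiable. -/
theorem hasDerivAt_max_zero_pow (n : ℕ) (x : ℝ) :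
    HasDerivAt (fun y : ℝ => max y 0 ^ (n + 2)) ((n + 2) * max x 0 ^ (n + 1)) x := by
  have hpow : HasDerivAt (fun y : ℝ => y ^ (n + 2)) ((n + 2) * x ^ (n + 1)) x := by
    simpa using hasDerivAt_pow (n + 2) x
  rcases lt_trichotomy x 0 with hx | rfl | hx
  · have hzero : HasDerivAt (fun _ : ℝ => (0 : ℝ)) ((n + 2) * max x 0 ^ (n + 1)) x := by
      simpa [max_eq_right hx.le] using hasDerivAt_const x (0 : ℝ)
    refine hzero.congr_of_eventuallyEq ?_
    filter_upwards [Iio_mem_nhds hx] with y hy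
    simp [max_eq_right (Set.mem_Iio.1 hy).le]
  · have hleft : HasDerivWithinAt (fun y : ℝ => max y 0 ^ (n + 2)) 0 (Set.Iic 0) 0 :=
      (hasDerivWithinAt_const (0 : ℝ) (Set.Iic 0) (0 : ℝ)).congr
        (fun y hy => by simp [max_eq_right (Set.mem_Iic.1 hy)]) (by simp)
    have hright : HasDerivWithinAt (fun y : ℝ => max y 0 ^ (n + 2)) 0 (Set.Ici 0) 0 := by
      refine HasDerivWithinAt.congr (f := fun y : ℝ => y ^ (n + 2)) ?_
        (fun y hy => by simp [max_eq_left (Set.mem_Ici.1 hy)]) (by simp)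
      simpa using hpow.hasDerivWithinAt (s := Set.Ici 0)
    simpa using hleft.union hright
  · rw [max_eq_left hx.le]
    refine hpow.congr_of_eventuallyEq ?_
    filter_upwards [Ioi_mem_nhds hx] with y hy
    simp [max_eq_left (Set.mem_Ioi.1 hy).le]

/-- A function whose derivative dominates that of another one grows at least as much. -/
theorem sub_le_sub_of_hasDerivAt_le {f f' g g' : ℝ → ℝ} {a b : ℝ} (hab : a ≤ b)
    (hf : ∀ t ∈ Set.Icc a b, HasDerivAt f (f' t) t)
    (hg : ∀ t ∈ Set.Icc a b, HasDerivAt g (g' t) t)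
    (hle : ∀ t ∈ Set.Icc a b, g' t ≤ f' t) : g b - g a ≤ f b - f a := by
  have hderiv : ∀ t ∈ Set.Icc a b, HasDerivAt (fun s => f s - g s) (f' t - g' t) t :=
    fun t ht => (hf t ht).sub (hg t ht)
  have hmono : MonotoneOn (fun s => f s - g s) (Set.Icc a b) := by
    refine monotoneOn_of_deriv_nonneg (convex_Icc a b)
      (fun t ht => (hderiv t ht).continuousAt.continuousWithinAt)
      (fun t ht => (hderiv t (interior_subset ht)).differentiableAt.differentiableWithinAt) ?_
    intro t ht
    rw [(hderiv t (interior_subset ht)).deriv]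
    exact sub_nonneg.2 (hle t (interior_subset ht))
  have := hmono (Set.left_mem_Icc.2 hab) (Set.right_mem_Icc.2 hab) hab
  dsimp only at this
  linarith

/-- The positive part, smoothed on `[-h, h]`. -/
noncomputable def smoothPosPart (h x : ℝ) : ℝ :=
  (max (x + h) 0 ^ 2 - max (x - h) 0 ^ 2) / (4 * h)

/-- The derivative of `smoothPosPart`: a ramp from `0` to `1` on `[-h, h]`. -/
noncomputable def ramp (h x : ℝ) : ℝ :=
  (max (x + h) 0 - max (x - h) 0) / (2 * h)

/-- An antiderivative of `smoothPosPart`. -/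
noncomputable def smoothPosPartPrimitive (h x : ℝ) : ℝ :=
  (max (x + h) 0 ^ 3 - max (x - h) 0 ^ 3) / (12 * h)

theorem hasDerivAt_smoothPosPart (h x : ℝ) :
    HasDerivAt (smoothPosPart h) (ramp h x) x := by
  have hadd := (hasDerivAt_max_zero_pow 0 (x + h)).comp_add_const x h
  have hsub := (hasDerivAt_max_zero_pow 0 (x - h)).comp_sub_const x h
  refine ((hadd.sub hsub).div_const (4 * h)).congr_deriv ?_
  rw [ramp, show 4 * h = 2 * (2 * h) by ring, ← mul_div_mul_left _ (2 * h) two_ne_zero]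
  congr 1
  push_cast
  ring

theorem hasDerivAt_smoothPosPartPrimitive (h x : ℝ) :
    HasDerivAt (smoothPosPartPrimitive h) (smoothPosPart h x) x := by
  have hadd := (hasDerivAt_max_zero_pow 1 (x + h)).comp_add_const x h
  have hsub := (hasDerivAt_max_zero_pow 1 (x - h)).comp_sub_const x h
  refine ((hadd.sub hsub).div_const (12 * h)).congr_deriv ?_
  rw [smoothPosPart, show 12 * h = 3 * (4 * h) by ring,
    ← mul_div_mul_left _ (4 * h) three_ne_zero]
  congr 1
  push_cast
  ring

theorem continuous_ramp (h : ℝ) : Continuous (ramp h) := by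
  unfold ramp
  fun_prop

theorem ramp_nonneg {h : ℝ} (hh : 0 < h) (x : ℝ) : 0 ≤ ramp h x :=
  div_nonneg (sub_nonneg.2 (max_le_max_right 0 (by linarith))) (by linarith)

theorem ramp_le_one {h : ℝ} (hh : 0 < h) (x : ℝ) : ramp h x ≤ 1 := by
  rw [ramp, div_le_one (by linarith), sub_le_iff_le_add]
  refine max_le ?_ ?_
  · linarith [le_max_left (x - h) 0]
  · linarith [le_max_right (x - h) 0]

theorem smoothPosPart_nonneg {h : ℝ} (hh : 0 < h) (x : ℝ) : 0 ≤ smoothPosPart h x := by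
  refine div_nonneg (sub_nonneg.2 ?_) (by linarith)
  exact pow_le_pow_left₀ (le_max_right _ _) (max_le_max_right 0 (by linarith)) 2

theorem smoothPosPart_of_le_neg {h x : ℝ} (hh : 0 < h) (hx : x ≤ -h) :
    smoothPosPart h x = 0 := by
  rw [smoothPosPart, max_eq_right (by linarith), max_eq_right (by linarith)]
  simp

theorem smoothPosPart_of_le {h x : ℝ} (hh : 0 < h) (hx : h ≤ x) : smoothPosPart h x = x := by
  rw [smoothPosPart, max_eq_left (by linarith), max_eq_left (by linarith)]
  field_simp
  ring

theorem smoothPosPartPrimitive_of_le_neg {h x : ℝ} (hh : 0 < h) (hx : x ≤ -h) :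
    smoothPosPartPrimitive h x = 0 := by
  rw [smoothPosPartPrimitive, max_eq_right (by linarith), max_eq_right (by linarith)]
  simp

theorem smoothPosPartPrimitive_of_le {h x : ℝ} (hh : 0 < h) (hx : h ≤ x) :
    smoothPosPartPrimitive h x = x ^ 2 / 2 + h ^ 2 / 6 := by
  rw [smoothPosPartPrimitive, max_eq_left (by linarith), max_eq_left (by linarith)]
  field_simp
  ring

/-- The set of horizons admitting a trajectory of the double integrator from `(1, 1)` to the
origin with `x₂ ≥ -1` and `|u| ≤ 1`. -/
def admissibleHorizons : Set ℝ :=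
  {T : ℝ | 0 ≤ T ∧ ∃ (x : ℝ → ℝ × ℝ) (u : ℝ → ℝ),
    Measurable u ∧
    (∀ t ∈ Set.Icc (0 : ℝ) T, HasDerivAt (fun s => (x s).1) ((x t).2) t) ∧
    (∀ t ∈ Set.Icc (0 : ℝ) T, HasDerivAt (fun s => (x s).2) (u t) t) ∧
    (∀ t ∈ Set.Icc (0 : ℝ) T, -1 ≤ (x t).2) ∧
    (∀ t ∈ Set.Icc (0 : ℝ) T, -1 ≤ u t ∧ u t ≤ 1) ∧
    x 0 = (1, 1) ∧ x T = (0, 0)}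

/-- Braking, coasting at speed `-1` and braking again, with control transitions of width `2h`,
reaches the origin at time `7/2 + h² / 3`. -/
theorem add_sq_div_mem_admissibleHorizons {h : ℝ} (hh : 0 < h) (hh' : h ≤ 1 / 2) :
    7 / 2 + h ^ 2 / 3 ∈ admissibleHorizons := by
  set T := 7 / 2 + h ^ 2 / 3 with hT
  have hT' : 7 / 2 ≤ T := by rw [hT]; linarith [sq_nonneg h]
  refine ⟨by linarith,
    fun t => (1 - t + smoothPosPartPrimitive h 2 - smoothPosPartPrimitive h (2 - t) +
        smoothPosPartPrimitive h (t - (T - 1)),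
      -1 + smoothPosPart h (2 - t) + smoothPosPart h (t - (T - 1))),
    fun t => -ramp h (2 - t) + ramp h (t - (T - 1)), ?_, ?_, ?_, ?_, ?_, ?_, ?_⟩
  · have := continuous_ramp h
    exact Continuous.measurable (by fun_prop)
  · intro t _
    have hfst := (hasDerivAt_smoothPosPartPrimitive h (2 - t)).comp_const_sub 2 t
    have hsnd := (hasDerivAt_smoothPosPartPrimitive h (t - (T - 1))).comp_sub_const t (T - 1)
    refine ((((((hasDerivAt_id t).const_sub 1).add_const _).sub hfst).add hsnd)).congr_deriv ?_
    ring
  · intro t _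
    have hfst := (hasDerivAt_smoothPosPart h (2 - t)).comp_const_sub 2 t
    have hsnd := (hasDerivAt_smoothPosPart h (t - (T - 1))).comp_sub_const t (T - 1)
    exact (hfst.const_add (-1)).add hsnd
  · intro t _
    dsimp only
    linarith [smoothPosPart_nonneg hh (2 - t), smoothPosPart_nonneg hh (t - (T - 1))]
  · intro t _
    constructor <;>
      linarith [ramp_nonneg hh (2 - t), ramp_nonneg hh (t - (T - 1)), ramp_le_one hh (2 - t),
        ramp_le_one hh (t - (T - 1))]
  · refine Prod.ext ?_ ?_
    · dsimp only
      rw [smoothPosPartPrimitive_of_le_neg (x := 0 - (T - 1)) hh (by linarith)]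
      simp
    · dsimp only
      rw [smoothPosPart_of_le_neg (x := 0 - (T - 1)) hh (by linarith),
        smoothPosPart_of_le hh (by linarith)]
      norm_num
  · refine Prod.ext ?_ ?_
    · dsimp only
      rw [smoothPosPartPrimitive_of_le_neg (x := 2 - T) hh (by linarith),
        smoothPosPartPrimitive_of_le (x := 2) hh (by linarith),
        smoothPosPartPrimitive_of_le (x := T - (T - 1)) hh (by linarith), hT]
      ring
    · dsimp only
      rw [smoothPosPart_of_le_neg (x := 2 - T) hh (by linarith),
        smoothPosPart_of_le hh (by linarith)]
      ring

theorem le_of_mem_admissibleHorizons {T : ℝ} (hmem : T ∈ admissibleHorizons) : 7 / 2 ≤ T := by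
  obtain ⟨hT, x, u, -, hpos, hvel, hstate, hctrl, hx0, hxT⟩ := hmem
  have hstart : ∀ t ∈ Set.Icc 0 T, 1 - t ≤ (x t).2 := by
    intro t ht
    have hsub : ∀ s ∈ Set.Icc 0 t, s ∈ Set.Icc 0 T := fun s hs => ⟨hs.1, hs.2.trans ht.2⟩
    have := sub_le_sub_of_hasDerivAt_le ht.1 (fun s hs => hvel s (hsub s hs))
      (fun s _ => hasDerivAt_neg s) (fun s hs => (hctrl s (hsub s hs)).1)
    simp only [hx0] at this
    linarith
  have hend : ∀ t ∈ Set.Icc 0 T, t - T ≤ (x t).2 := by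
    intro t ht
    have hsub : ∀ s ∈ Set.Icc t T, s ∈ Set.Icc 0 T := fun s hs => ⟨ht.1.trans hs.1, hs.2⟩
    have := sub_le_sub_of_hasDerivAt_le ht.2 (fun s _ => hasDerivAt_id s)
      (fun s hs => hvel s (hsub s hs)) (fun s hs => (hctrl s (hsub s hs)).2)
    simp only [hxT, id] at this
    linarith
  have hposStart : ∀ t ∈ Set.Icc 0 T, 1 + t - t ^ 2 / 2 ≤ (x t).1 := by
    intro t ht
    have hsub : ∀ s ∈ Set.Icc 0 t, s ∈ Set.Icc 0 T := fun s hs => ⟨hs.1, hs.2.trans ht.2⟩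
    have := sub_le_sub_of_hasDerivAt_le (g := fun s => s - s ^ 2 / 2) (g' := fun s => 1 - s) ht.1
      (fun s hs => hpos s (hsub s hs))
      (fun s _ => ((hasDerivAt_id s).sub ((hasDerivAt_pow 2 s).div_const 2)).congr_deriv
        (by norm_num)) (fun s hs => hstart s (hsub s hs))
    simp only [hx0] at this
    linarith
  have hposEnd : ∀ t ∈ Set.Icc 0 T, (x t).1 ≤ (T - t) ^ 2 / 2 := by
    intro t ht
    have hsub : ∀ s ∈ Set.Icc t T, s ∈ Set.Icc 0 T := fun s hs => ⟨ht.1.trans hs.1, hs.2⟩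
    have := sub_le_sub_of_hasDerivAt_le (g := fun s => s ^ 2 / 2 - s * T) (g' := fun s => s - T)
      ht.2 (fun s hs => hpos s (hsub s hs))
      (fun s _ => (((hasDerivAt_pow 2 s).div_const 2).sub
        ((hasDerivAt_id s).mul_const T)).congr_deriv (by norm_num))
      (fun s hs => hend s (hsub s hs))
    simp only [hxT] at this
    linarith
  have hT1 : 1 ≤ T := by
    have := hstart T ⟨hT, le_rfl⟩
    simp only [hxT] at this
    linarith
  rcases lt_or_ge T 3 with hT3 | hT3
  · have hmid : (1 + T) / 2 ∈ Set.Icc 0 T := ⟨by linarith, by linarith⟩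
    nlinarith [hposStart _ hmid, hposEnd _ hmid]
  · have hcoast := sub_le_sub_of_hasDerivAt_le (a := 2) (b := T - 1) (by linarith)
      (fun s hs => hpos s ⟨by linarith [hs.1], by linarith [hs.2]⟩)
      (fun s _ => hasDerivAt_neg s)
      (fun s hs => hstate s ⟨by linarith [hs.1], by linarith [hs.2]⟩)
    have h2 := hposStart 2 ⟨by norm_num, by linarith⟩
    have hlast := hposEnd (T - 1) ⟨by linarith, by linarith⟩
    norm_num at h2 hlast
    linarith

/-- For the double integrator `x₁' = x₂`, `x₂' = u` with state constraint `x₂ ≥ -1`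
and input constraint `-1 ≤ u ≤ 1`, the infimum of horizon lengths `T` over all
admissible trajectories steering `(1,1)` at time `0` to `(0,0)` at time `T`
equals `3.5`. -/
theorem double_integrator_minimum_time :
    sInf {T : ℝ | 0 ≤ T ∧ ∃ (x : ℝ → ℝ × ℝ) (u : ℝ → ℝ),
        Measurable u ∧
        (∀ t ∈ Set.Icc (0 : ℝ) T, HasDerivAt (fun s => (x s).1) ((x t).2) t) ∧
        (∀ t ∈ Set.Icc (0 : ℝ) T, HasDerivAt (fun s => (x s).2) (u t) t) ∧
        (∀ t ∈ Set.Icc (0 : ℝ) T, -1 ≤ (x t).2) ∧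
        (∀ t ∈ Set.Icc (0 : ℝ) T, -1 ≤ u t ∧ u t ≤ 1) ∧
        x 0 = (1, 1) ∧ x T = (0, 0)} = 3.5 := by
  change sInf admissibleHorizons = 3.5
  have hglb : IsGLB admissibleHorizons (7 / 2) := by
    refine ⟨fun T hT => le_of_mem_admissibleHorizons hT, fun b hb => ?_⟩
    refine le_of_forall_pos_le_add fun ε hε => ?_
    have hpos : 0 < min ε (1 / 2) := lt_min hε (by norm_num)
    have hle := hb (add_sq_div_mem_admissibleHorizons hpos (min_le_right _ _))
    nlinarith [min_le_left ε (1 / 2), min_le_right ε (1 / 2)]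
  rw [hglb.csInf_eq ⟨_, add_sq_div_mem_admissibleHorizons one_half_pos le_rfl⟩]
  norm_num
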